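/- Fix 0 < q < 1 and integers N ≥ 2, 1 ≤ n ≤ N-1. For α > 0, the q-Krawtchouk polynomial K_n^{(α)}(·;q) has n distinct real zeros x_1(α) < ⋯ < x_n(α), and for each j ∈ {1,...,n} the zero x_j(α) is a strictly decreasing function of α on (0, ∞). -/

import Mathlib

/-- q-Pochhammer symbol `(a;q)_k = ∏_{j=0}^{k-1} (1 - a q^j)`. -/
noncomputable def qpoch (q a : ℝ) (k : ℕ) : ℝ := ∏ j ∈ Finset.range k, (1 - a * q ^ j)

/-- q-Krawtchouk polynomial `K_n^{(α)}(x;q)`. -/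
noncomputable def qKrawtchoukPoly (q : ℝ) (N n : ℕ) (α x : ℝ) : ℝ :=
  ∑ k ∈ Finset.range (n + 1),
    qpoch q (q ^ (-(n : ℤ))) k * qpoch q (-α * q ^ n) k * qpoch q x k /
      (qpoch q (q ^ ((1 : ℤ) - (N : ℤ))) k * qpoch q q k) * q ^ k

lemma qpoch_succ (q a : ℝ) (k : ℕ) : qpoch q a (k + 1) = qpoch q a k * (1 - a * q ^ k) :=
  Finset.prod_range_succ _ _

lemma qpoch_succ' (q a : ℝ) (k : ℕ) : qpoch q a (k + 1) = (1 - a) * qpoch q (a * q) k := by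
  unfold qpoch
  rw [Finset.prod_range_succ', mul_comm]
  congr 1
  · simp
  · exact Finset.prod_congr rfl fun j _ => by ring

lemma qpoch_add (q a : ℝ) (k l : ℕ) :
    qpoch q a (k + l) = qpoch q a k * qpoch q (a * q ^ k) l := by
  unfold qpoch
  rw [Finset.prod_range_add]
  congr 1
  exact Finset.prod_congr rfl fun j _ => by ring

lemma qpoch_self_pos {q : ℝ} (hq0 : 0 < q) (hq1 : q < 1) (k : ℕ) : 0 < qpoch q q k := by
  refine Finset.prod_pos fun j _ => ?_
  have := pow_lt_one₀ hq0.le hq1 (Nat.succ_ne_zero j)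
  rw [pow_succ'] at this
  linarith

lemma qpoch_neg_pos {q a : ℝ} (hq0 : 0 < q) (ha : 0 < a) (k : ℕ) : 0 < qpoch q (-a) k :=
  Finset.prod_pos fun j _ => by have : 0 < a * q ^ j := by positivity
                                linarith

lemma neg_one_pow_mul_qpoch_inv_pos {q : ℝ} (hq0 : 0 < q) (hq1 : q < 1) {M k : ℕ} (hk : k ≤ M) :
    0 < (-1) ^ k * qpoch q (q⁻¹ ^ M) k := by
  have h : (-1) ^ k * qpoch q (q⁻¹ ^ M) k = ∏ j ∈ Finset.range k, (q⁻¹ ^ M * q ^ j - 1) := by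
    rw [qpoch, ← Finset.card_range k, ← Finset.prod_const, Finset.card_range,
      ← Finset.prod_mul_distrib]
    exact Finset.prod_congr rfl fun j _ => by ring
  rw [h]
  refine Finset.prod_pos fun j hj => ?_
  have hj' : j < M := (Finset.mem_range.1 hj).trans_le hk
  have h1 : q ^ M < q ^ j := pow_lt_pow_right_of_lt_one₀ hq0 hq1 hj'
  rw [inv_pow, inv_mul_eq_div, sub_pos, one_lt_div (by positivity)]
  exact h1

lemma qpoch_inv_ne_zero {q : ℝ} (hq0 : 0 < q) (hq1 : q < 1) {M k : ℕ} (hk : k ≤ M) :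
    qpoch q (q⁻¹ ^ M) k ≠ 0 :=
  right_ne_zero_of_mul (neg_one_pow_mul_qpoch_inv_pos hq0 hq1 hk).ne'

lemma qpoch_inv_eq_zero {q : ℝ} (hq0 : 0 < q) {m k : ℕ} (hk : m < k) :
    qpoch q (q⁻¹ ^ m) k = 0 := by
  refine Finset.prod_eq_zero (Finset.mem_range.2 hk) ?_
  rw [← mul_pow, inv_mul_cancel₀ hq0.ne', one_pow, sub_self]

/-- The coefficients of `∏_{j=1}^m (1 - u q^{-j})` obey the `q`-Pascal rule. -/
lemma qpoch_inv_div_succ {q : ℝ} (hq0 : 0 < q) (hq1 : q < 1) (m y : ℕ) :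
    qpoch q (q⁻¹ ^ (m + 1)) (y + 1) / qpoch q q (y + 1) =
      qpoch q (q⁻¹ ^ m) (y + 1) / qpoch q q (y + 1)
        - q⁻¹ ^ (m + 1) * (qpoch q (q⁻¹ ^ m) y / qpoch q q y) := by
  have h1 := (qpoch_self_pos hq0 hq1 y).ne'
  have h4 : 1 - q * q ^ y ≠ 0 :=
    right_ne_zero_of_mul (qpoch_succ q q y ▸ (qpoch_self_pos hq0 hq1 (y + 1)).ne')
  have h3 : q⁻¹ ^ (m + 1) * q = q⁻¹ ^ m := by
    rw [pow_succ, mul_assoc, inv_mul_cancel₀ hq0.ne', mul_one]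
  rw [qpoch_succ', h3, qpoch_succ q (q⁻¹ ^ m), qpoch_succ q q]
  rw [← h3]
  generalize q⁻¹ ^ (m + 1) = a
  field_simp
  ring

/-- The terminating `q`-binomial theorem. -/
lemma sum_qpoch_inv_div_mul_pow {q : ℝ} (hq0 : 0 < q) (hq1 : q < 1) (m : ℕ) (u : ℝ) :
    ∑ y ∈ Finset.range (m + 1), qpoch q (q⁻¹ ^ m) y / qpoch q q y * u ^ y =
      ∏ j ∈ Finset.range m, (1 - u * q⁻¹ ^ (j + 1)) := by
  induction m with
  | zero => simp [qpoch]
  | succ m ih =>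
    rw [Finset.prod_range_succ, ← ih, Finset.sum_range_succ']
    have h0 : ∀ a, qpoch q a 0 = 1 := fun a => by simp [qpoch]
    have h1 : ∑ y ∈ Finset.range (m + 1),
        qpoch q (q⁻¹ ^ m) (y + 1) / qpoch q q (y + 1) * u ^ (y + 1) + 1 =
        ∑ y ∈ Finset.range (m + 1), qpoch q (q⁻¹ ^ m) y / qpoch q q y * u ^ y := by
      rw [Finset.sum_range_succ, qpoch_inv_eq_zero hq0 (Nat.lt_succ_self m),
        Finset.sum_range_succ' _ m]
      simp [h0]
    rw [mul_sub, mul_one]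
    nth_rewrite 1 [← h1]
    simp only [qpoch_inv_div_succ hq0 hq1, sub_mul, Finset.sum_sub_distrib, h0, pow_zero, div_one,
      mul_one, Finset.sum_mul]
    rw [add_sub_right_comm]
    congr 2
    exact Finset.sum_congr rfl fun y _ => by ring

lemma sum_qpoch_inv_mul_qpoch_eq_zero {q : ℝ} (hq0 : 0 < q) (hq1 : q < 1) (n : ℕ) (a : ℝ)
    (d e : ℕ) (h : e + d < n) :
    ∑ k ∈ Finset.range (n + 1),
      qpoch q (q⁻¹ ^ n) k / qpoch q q k * (q ^ (e + 1)) ^ k * qpoch q (a * q ^ k) d = 0 := by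
  induction d generalizing e with
  | zero =>
    simp only [qpoch, Finset.range_zero, Finset.prod_empty, mul_one]
    have := sum_qpoch_inv_div_mul_pow hq0 hq1 n (q ^ (e + 1))
    simp only [qpoch] at this
    rw [this]
    refine Finset.prod_eq_zero (Finset.mem_range.2 (show e < n by omega)) ?_
    rw [← mul_pow, mul_inv_cancel₀ hq0.ne', one_pow, sub_self]
  | succ d ih =>
    have h1 := ih e (by omega)
    have h2 := ih (e + 1) (by omega)
    refine Eq.trans ?_ (sub_eq_zero.2 (h1.trans (mul_eq_zero_of_right (a * q ^ d) h2).symm))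
    rw [Finset.mul_sum, ← Finset.sum_sub_distrib]
    refine Finset.sum_congr rfl fun k _ => ?_
    rw [qpoch_succ, pow_succ q (e + 1), mul_pow]
    ring

lemma sum_qpoch_inv_mul_qpoch_node {q : ℝ} (hq0 : 0 < q) (hq1 : q < 1) {M k : ℕ} (hk : k ≤ M)
    (u : ℝ) :
    ∑ x ∈ Finset.range (M + 1),
      qpoch q (q⁻¹ ^ M) x / qpoch q q x * u ^ x * qpoch q (q⁻¹ ^ x) k =
    qpoch q (q⁻¹ ^ M) k * (∏ i ∈ Finset.range k, (-u * q⁻¹ ^ (i + 1))) *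
      ∏ j ∈ Finset.Ico k M, (1 - u * q⁻¹ ^ (j + 1)) := by
  induction k generalizing u with
  | zero =>
    simpa [qpoch] using sum_qpoch_inv_div_mul_pow hq0 hq1 M u
  | succ k ih =>
    have h1 := ih (by omega) u
    have h2 := ih (by omega) (u * q⁻¹)
    have h3 : ∑ x ∈ Finset.range (M + 1),
        qpoch q (q⁻¹ ^ M) x / qpoch q q x * u ^ x * qpoch q (q⁻¹ ^ x) (k + 1) =
      ∑ x ∈ Finset.range (M + 1),
        qpoch q (q⁻¹ ^ M) x / qpoch q q x * u ^ x * qpoch q (q⁻¹ ^ x) k - q ^ k *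
      ∑ x ∈ Finset.range (M + 1),
        qpoch q (q⁻¹ ^ M) x / qpoch q q x * (u * q⁻¹) ^ x * qpoch q (q⁻¹ ^ x) k := by
      rw [Finset.mul_sum, ← Finset.sum_sub_distrib]
      refine Finset.sum_congr rfl fun k _ => ?_
      rw [qpoch_succ, mul_pow]
      ring
    have h4 : ∏ i ∈ Finset.range k, (-(u * q⁻¹) * q⁻¹ ^ (i + 1)) =
        q⁻¹ ^ k * ∏ i ∈ Finset.range k, (-u * q⁻¹ ^ (i + 1)) := by
      rw [show q⁻¹ ^ k = ∏ _i ∈ Finset.range k, q⁻¹ by simp, ← Finset.prod_mul_distrib]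
      exact Finset.prod_congr rfl fun j _ => by ring
    have h5 : ∏ j ∈ Finset.Ico k M, (1 - u * q⁻¹ * q⁻¹ ^ (j + 1)) =
        (∏ j ∈ Finset.Ico (k + 1) M, (1 - u * q⁻¹ ^ (j + 1))) * (1 - u * q⁻¹ ^ (M + 1)) := by
      rw [← Finset.prod_Ico_succ_top (by omega), ← Finset.prod_Ico_add' _ k M 1]
      exact Finset.prod_congr rfl fun j _ => by ring
    have h6 : q ^ k * q⁻¹ ^ k = 1 := by rw [← mul_pow, mul_inv_cancel₀ hq0.ne', one_pow]
    have h7 : q⁻¹ ^ (k + 1) * q ^ k = q⁻¹ := by rw [pow_succ', mul_assoc, mul_comm (_ ^ k), h6, mul_one]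
    rw [h3, h1, h2, h4, h5, Finset.prod_eq_prod_Ico_succ_bot (show k < M by omega), qpoch_succ,
      Finset.prod_range_succ]
    generalize (∏ j ∈ Finset.Ico (k + 1) M, (1 - u * q⁻¹ ^ (j + 1))) = A
    generalize ∏ i ∈ Finset.range k, (-u * q⁻¹ ^ (i + 1)) = B
    generalize qpoch q (q⁻¹ ^ M) k = C
    rw [pow_succ _ M]
    linear_combination (-C * B * A * (1 - u * q⁻¹ ^ M * q⁻¹)) * h6 - C * B * A * u * q⁻¹ ^ M * h7

/-- Orthogonality of the `q`-Krawtchouk polynomial to lower powers on the nodes `q^{-x}`. -/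
lemma sum_weight_mul_qKrawtchouk_mul_pow {q : ℝ} (hq0 : 0 < q) (hq1 : q < 1) {M n m : ℕ}
    (hn : n ≤ M) (hm : m < n) {α : ℝ} (hα : 0 < α) :
    ∑ x ∈ Finset.range (M + 1),
      (-1) ^ x * (qpoch q (q⁻¹ ^ M) x / qpoch q q x) * α⁻¹ ^ x *
        qKrawtchoukPoly q (M + 1) n α (q⁻¹ ^ x) * (q⁻¹ ^ x) ^ m = 0 := by
  set u : ℝ := -α⁻¹ * q⁻¹ ^ m with hu
  set W : ℝ := ∏ j ∈ Finset.range M, (1 - u * q⁻¹ ^ (j + 1)) with hW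
  set a : ℝ := α * q ^ (m + 1) with ha
  have hapos : 0 < a := by positivity
  obtain ⟨d, hd⟩ : ∃ d, n = m + 1 + d := ⟨n - (m + 1), by omega⟩
  have hz := sum_qpoch_inv_mul_qpoch_eq_zero hq0 hq1 n (-a) d 0 (by omega)
  have key : ∀ k ∈ Finset.range (n + 1),
      (∏ i ∈ Finset.range k, (-u * q⁻¹ ^ (i + 1))) *
        ∏ j ∈ Finset.Ico k M, (1 - u * q⁻¹ ^ (j + 1)) = W / qpoch q (-a) k := by
    intro k hk
    have hk' : k ≤ M := by have := Finset.mem_range.1 hk; omega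
    rw [hW, ← Finset.prod_range_mul_prod_Ico _ hk', eq_div_iff (qpoch_neg_pos hq0 hapos k).ne',
      mul_right_comm, qpoch, ← Finset.prod_mul_distrib]
    congr 1
    refine Finset.prod_congr rfl fun i _ => ?_
    rw [hu, ha, inv_pow, inv_pow]
    field_simp
    ring
  have key2 : ∀ k, qpoch q (-α * q ^ n) k / qpoch q (-a) k =
      qpoch q (-a * q ^ k) d / qpoch q (-a) d := by
    intro k
    rw [div_eq_div_iff (qpoch_neg_pos hq0 hapos k).ne' (qpoch_neg_pos hq0 hapos d).ne',
      mul_comm (qpoch q (-a * q ^ k) d), ← qpoch_add, add_comm k, qpoch_add, mul_comm]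
    congr 2
    rw [ha, hd]; ring
  calc _ = ∑ x ∈ Finset.range (M + 1), ∑ k ∈ Finset.range (n + 1),
        qpoch q (q⁻¹ ^ n) k * qpoch q (-α * q ^ n) k / (qpoch q (q⁻¹ ^ M) k * qpoch q q k) * q ^ k
          * (qpoch q (q⁻¹ ^ M) x / qpoch q q x * u ^ x * qpoch q (q⁻¹ ^ x) k) := by
        refine Finset.sum_congr rfl fun x _ => ?_
        have e1 : q ^ (-(n : ℤ)) = q⁻¹ ^ n := by simp
        have e2 : q ^ ((1 : ℤ) - ((M + 1 : ℕ) : ℤ)) = q⁻¹ ^ M := by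
          rw [show (1 : ℤ) - ((M + 1 : ℕ) : ℤ) = -(M : ℤ) by push_cast; ring]; simp
        rw [qKrawtchoukPoly, Finset.mul_sum, Finset.sum_mul, e1, e2]
        refine Finset.sum_congr rfl fun k _ => ?_
        rw [hu, mul_pow, neg_pow α⁻¹, ← pow_mul, ← pow_mul, mul_comm m x]
        ring
    _ = ∑ k ∈ Finset.range (n + 1), W / qpoch q (-a) d *
          (qpoch q (q⁻¹ ^ n) k / qpoch q q k * (q ^ (0 + 1)) ^ k * qpoch q (-a * q ^ k) d) := by
        rw [Finset.sum_comm]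
        refine Finset.sum_congr rfl fun k hk => ?_
        have hk' : k ≤ M := by have := Finset.mem_range.1 hk; omega
        have h1 := qpoch_inv_ne_zero hq0 hq1 hk'
        have h2 := (qpoch_self_pos hq0 hq1 k).ne'
        have h3 := (qpoch_neg_pos hq0 hapos k).ne'
        rw [← Finset.mul_sum, sum_qpoch_inv_mul_qpoch_node hq0 hq1 hk', mul_assoc (qpoch q _ k),
          key k hk]
        have := key2 k
        calc _ = W * (qpoch q (q⁻¹ ^ n) k / qpoch q q k * q ^ k) *
              (qpoch q (-α * q ^ n) k / qpoch q (-a) k) := by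
              generalize qpoch q (q⁻¹ ^ M) k = A at *
              field_simp
          _ = _ := by rw [this]; ring
    _ = 0 := by rw [← Finset.mul_sum, hz, mul_zero]

open Polynomial in
lemma eq_zero_of_eval_node_eq_zero {M : ℕ} {z : ℕ → ℝ} (hz : StrictMono z) {g : ℝ[X]}
    (hg : g.natDegree ≤ M) (h : ∀ x ∈ Finset.range (M + 1), g.eval (z x) = 0) : g = 0 := by
  refine Polynomial.eq_zero_of_natDegree_lt_card_of_eval_eq_zero' g
    ((Finset.range (M + 1)).map ⟨z, hz.injective⟩) ?_ (by simpa [Nat.lt_succ_iff] using hg)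
  intro y hy
  obtain ⟨x, hx, rfl⟩ := Finset.mem_map.1 hy
  exact h x hx

open Polynomial in
/-- An orthogonal polynomial for a discrete positive weight has no factor `(X - a)² + b²`. -/
lemma not_sq_add_sq_dvd_of_orthogonal {M n : ℕ} (hnM : n ≤ M) (hn : 1 ≤ n) {z w : ℕ → ℝ}
    (hz : StrictMono z) (hw : ∀ x ∈ Finset.range (M + 1), 0 < w x) {P : ℝ[X]}
    (hP : P.natDegree = n)
    (horth : ∀ g : ℝ[X], g.natDegree < n →
      ∑ x ∈ Finset.range (M + 1), w x * P.eval (z x) * g.eval (z x) = 0) (a b : ℝ) :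
    ¬ ((X - C a) ^ 2 + C (b ^ 2)) ∣ P := by
  rintro ⟨h, rfl⟩
  have hdeg : ((X - C a) ^ 2 + C (b ^ 2)).natDegree = 2 := by compute_degree!
  have h0 : h ≠ 0 := by
    rintro rfl
    simp at hP
    omega
  have hq0 : ((X - C a) ^ 2 + C (b ^ 2)) ≠ 0 := by
    intro h; rw [h] at hdeg; simp at hdeg
  rw [natDegree_mul hq0 h0, hdeg] at hP
  have hsum := horth h (by omega)
  have hnonneg : ∀ x ∈ Finset.range (M + 1),
      0 ≤ w x * (((X - C a) ^ 2 + C (b ^ 2)) * h).eval (z x) * h.eval (z x) := by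
    intro x hx
    have := (hw x hx).le
    have e : w x * (((X - C a) ^ 2 + C (b ^ 2)) * h).eval (z x) * h.eval (z x) =
      w x * (((z x - a) ^ 2 + b ^ 2) * (h.eval (z x)) ^ 2) := by simp; ring
    rw [e]
    positivity
  rw [Finset.sum_eq_zero_iff_of_nonneg hnonneg] at hsum
  have : (X - C a) * h = 0 := by
    refine eq_zero_of_eval_node_eq_zero hz (M := M) ?_ fun x hx => ?_
    · rw [natDegree_mul (X_sub_C_ne_zero a) h0, natDegree_X_sub_C]; omega
    · have h1 := hsum x hx
      have h2 := (hw x hx).ne'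
      simp only [eval_mul, eval_add, eval_pow, eval_sub, eval_X, eval_C, mul_eq_zero, h2,
        false_or] at h1 ⊢
      rcases h1 with (h1 | h1) | h1
      · left; nlinarith [sq_nonneg (z x - a), sq_nonneg b]
      · exact Or.inr h1
      · exact Or.inr h1
  exact mul_ne_zero (X_sub_C_ne_zero a) h0 this

open Polynomial in
lemma card_roots_toFinset_of_not_sq_add_sq_dvd {P : ℝ[X]} (hP : P ≠ 0)
    (h : ∀ a b : ℝ, ¬ ((X - C a) ^ 2 + C (b ^ 2)) ∣ P) :
    P.roots.toFinset.card = P.natDegree := by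
  have hnodup : P.roots.Nodup := by
    rw [Multiset.nodup_iff_count_le_one]
    intro a
    rw [count_roots]
    by_contra! hc
    refine h a 0 ?_
    rw [zero_pow two_ne_zero, C_0, add_zero]
    exact (le_rootMultiplicity_iff hP).1 hc
  have hsplits : P.Splits := by
    refine Splits.of_splits_map (algebraMap ℝ ℂ) (IsAlgClosed.splits _) fun ζ hζ => ?_
    have hζ : aeval ζ P = 0 := by
      rw [aeval_def, ← eval_map]
      exact isRoot_of_mem_roots hζ
    by_cases him : ζ.im = 0
    · exact ⟨ζ.re, Complex.ext (by simp) (by simp [him])⟩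
    · refine (h ζ.re ζ.im ((dvd_of_eq ?_).trans
        (quadratic_dvd_of_aeval_eq_zero_im_ne_zero P hζ him))).elim
      rw [Complex.sq_norm, Complex.normSq_apply]
      simp only [C_add, C_mul, C_pow, map_ofNat]
      ring
  rw [Multiset.toFinset_card_of_nodup hnodup]
  exact hsplits.natDegree_eq_card_roots.symm

open Polynomial in
lemma card_roots_toFinset_of_orthogonal {M n : ℕ} (hnM : n ≤ M) (hn : 1 ≤ n) {z w : ℕ → ℝ}
    (hz : StrictMono z) (hw : ∀ x ∈ Finset.range (M + 1), 0 < w x) {P : ℝ[X]}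
    (hP : P.natDegree = n)
    (horth : ∀ g : ℝ[X], g.natDegree < n →
      ∑ x ∈ Finset.range (M + 1), w x * P.eval (z x) * g.eval (z x) = 0) :
    P.roots.toFinset.card = n := by
  rw [← hP]
  refine card_roots_toFinset_of_not_sq_add_sq_dvd ?_
    (not_sq_add_sq_dvd_of_orthogonal hnM hn hz hw hP horth)
  rintro rfl
  simp at hP
  omega

open Polynomial in
/-- The sign computation in the Markov theorem: `D` plays the role of the derivative of the
orthogonal polynomial `P` with respect to the parameter. -/
lemma eval_mul_eval_derivative_pos_of_orthogonal {M n : ℕ} (hnM : n ≤ M) (hn : 1 ≤ n)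
    {z w : ℕ → ℝ} (hz : StrictMono z) (hzlim : Filter.Tendsto z Filter.atTop Filter.atTop)
    (hw : ∀ x ∈ Finset.range (M + 1), 0 < w x) {P D : ℝ[X]}
    (hP : P.natDegree = n) (hD : D.natDegree ≤ n)
    (horth : ∀ g : ℝ[X], g.natDegree < n →
      ∑ x ∈ Finset.range (M + 1), w x * P.eval (z x) * g.eval (z x) = 0)
    (hder : ∀ g : ℝ[X], g.natDegree < n →
      ∑ x ∈ Finset.range (M + 1), w x * D.eval (z x) * g.eval (z x) =
      ∑ x ∈ Finset.range (M + 1), (x : ℝ) * (w x * P.eval (z x) * g.eval (z x)))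
    {y : ℝ} (hy : P.eval y = 0) : 0 < D.eval y * P.derivative.eval y := by
  obtain ⟨g, rfl⟩ := dvd_iff_isRoot.2 hy
  have hg0 : g ≠ 0 := by
    rintro rfl
    simp at hP
    omega
  have hXy := X_sub_C_ne_zero y
  rw [natDegree_mul hXy hg0, natDegree_X_sub_C] at hP
  have hquot : ∀ p : ℝ[X], ∃ h : ℝ[X], h.natDegree = p.natDegree - 1 ∧
      ∀ t, p.eval t = p.eval y + (t - y) * h.eval t := by
    intro p
    refine ⟨p /ₘ (X - C y), by rw [natDegree_divByMonic _ (monic_X_sub_C y), natDegree_X_sub_C],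
      fun t => ?_⟩
    conv_lhs => rw [← modByMonic_add_div p (X - C y), modByMonic_X_sub_C_eq_C_eval]
    simp
  obtain ⟨h, hh, hhe⟩ := hquot D
  obtain ⟨k, hk, hke⟩ := hquot g
  set S := ∑ x ∈ Finset.range (M + 1), w x * g.eval (z x) with hS
  have hDS : ∑ x ∈ Finset.range (M + 1), w x * D.eval (z x) * g.eval (z x) = D.eval y * S := by
    rw [← add_zero (D.eval y * S), ← horth h (by omega), hS, Finset.mul_sum,
      ← Finset.sum_add_distrib]
    refine Finset.sum_congr rfl fun x _ => ?_
    rw [hhe (z x)]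
    simp only [eval_mul, eval_sub, eval_X, eval_C]
    ring
  have hgS : ∑ x ∈ Finset.range (M + 1), w x * g.eval (z x) ^ 2 = g.eval y * S := by
    rw [← add_zero (g.eval y * S), ← horth k (by omega), hS, Finset.mul_sum,
      ← Finset.sum_add_distrib]
    refine Finset.sum_congr rfl fun x _ => ?_
    simp only [eval_mul, eval_sub, eval_X, eval_C]
    linear_combination (w x * g.eval (z x)) * hke (z x)
  have hgS_pos : 0 < g.eval y * S := by
    rw [← hgS]
    refine lt_of_le_of_ne (Finset.sum_nonneg fun x hx => by have := (hw x hx).le; positivity) ?_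
    intro h0
    rw [eq_comm, Finset.sum_eq_zero_iff_of_nonneg
      (fun x hx => by have := (hw x hx).le; positivity)] at h0
    refine hg0 (eq_zero_of_eval_node_eq_zero hz (M := M) (by omega) fun x hx => ?_)
    simpa [(hw x hx).ne'] using h0 x hx
  have hDS_pos : 0 < D.eval y * S := by
    obtain ⟨c, hc⟩ : ∃ c : ℝ, ∀ x : ℕ, z x ≠ y → 0 < ((x : ℝ) - c) * (z x - y) := by
      have hex : ∃ k, y < z k := (hzlim.eventually_gt_atTop y).exists
      classical
      refine ⟨(Nat.find hex : ℝ) - 1 / 2, fun x hx => ?_⟩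
      rcases lt_or_ge x (Nat.find hex) with hlt | hge
      · have h1 : z x < y := lt_of_le_of_ne (not_lt.1 (Nat.find_min hex hlt)) hx
        have h2 : (x : ℝ) + 1 ≤ Nat.find hex := by exact_mod_cast hlt
        exact mul_pos_of_neg_of_neg (by linarith) (by linarith)
      · have h1 : y < z x := (Nat.find_spec hex).trans_le (hz.monotone hge)
        have h2 : (Nat.find hex : ℝ) ≤ x := by exact_mod_cast hge
        exact mul_pos (by linarith) (by linarith)
    have hc0 : ∀ x : ℕ, 0 ≤ ((x : ℝ) - c) * (z x - y) := fun x => by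
      by_cases hx : z x = y
      · simp [hx]
      · exact (hc x hx).le
    have e : D.eval y * S = ∑ x ∈ Finset.range (M + 1),
        w x * ((((x : ℝ) - c) * (z x - y)) * g.eval (z x) ^ 2) := by
      rw [← hDS, hder g (by omega), ← sub_zero (∑ x ∈ _, _), ← mul_zero c,
        ← horth g (by omega), Finset.mul_sum, ← Finset.sum_sub_distrib]
      refine Finset.sum_congr rfl fun x _ => ?_
      simp only [eval_mul, eval_sub, eval_X, eval_C]
      ring
    have hnn : ∀ x ∈ Finset.range (M + 1),
        0 ≤ w x * ((((x : ℝ) - c) * (z x - y)) * g.eval (z x) ^ 2) := fun x hx => by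
      have h1 := (hw x hx).le
      have h2 := hc0 x
      positivity
    rw [e]
    refine lt_of_le_of_ne (Finset.sum_nonneg hnn) ?_
    intro h0
    rw [eq_comm, Finset.sum_eq_zero_iff_of_nonneg hnn] at h0
    refine mul_ne_zero hXy hg0 (eq_zero_of_eval_node_eq_zero hz (M := M) ?_ fun x hx => ?_)
    · rw [natDegree_mul hXy hg0, natDegree_X_sub_C]; omega
    · by_cases hx' : z x = y
      · simp [hx']
      · have := h0 x hx
        simp only [mul_eq_zero, (hw x hx).ne', false_or, pow_eq_zero_iff two_ne_zero] at this
        rcases this with this | this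
        · exact absurd (mul_eq_zero.2 this) (hc x hx').ne'
        · simp [this]
  have hfin : 0 < (D.eval y * g.eval y) * S ^ 2 := by
    have := mul_pos hDS_pos hgS_pos
    nlinarith
  have : 0 < D.eval y * g.eval y := pos_of_mul_pos_left hfin (sq_nonneg S)
  simpa [derivative_mul] using this

lemma strictAntiOn_Ioi_of_eventually {f : ℝ → ℝ}
    (hr : ∀ a > 0, ∀ᶠ b in nhdsWithin a (Set.Ioi a), f b < f a)
    (hl : ∀ a > 0, ∀ᶠ b in nhdsWithin a (Set.Iio a), f a < f b) :
    StrictAntiOn f (Set.Ioi 0) := by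
  intro a (ha : 0 < a) b _ hab
  set T : Set ℝ := {t | a < t ∧ t ≤ b ∧ ∀ u ∈ Set.Ioc a t, f u < f a} with hT
  have hright : ∀ s, a ≤ s → s < b → (∀ u ∈ Set.Ioc a s, f u < f a) → ∃ t ∈ T, s < t := by
    intro s hs hsb hlt
    have hle : f s ≤ f a := by
      rcases hs.eq_or_lt with rfl | hs'
      · exact le_rfl
      · exact (hlt s ⟨hs', le_rfl⟩).le
    obtain ⟨c, hc, hcs⟩ := mem_nhdsGT_iff_exists_Ioo_subset.1 (hr s (ha.trans_le hs))
    have hc : s < c := hc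
    obtain ⟨t, ht1, ht2⟩ := exists_between (lt_min hc hsb)
    refine ⟨t, ⟨hs.trans_lt ht1, (ht2.trans_le (min_le_right _ _)).le, fun u hu => ?_⟩, ht1⟩
    rcases le_or_gt u s with hus | hus
    · exact hlt u ⟨hu.1, hus⟩
    · exact (hcs ⟨hus, hu.2.trans_lt (ht2.trans_le (min_le_left _ _))⟩ : f u < f s).trans_le hle
  obtain ⟨t₀, ht₀, -⟩ := hright a le_rfl hab (fun u hu => absurd hu.1 (not_lt.2 hu.2))
  have hbdd : BddAbove T := ⟨b, fun t ht => ht.2.1⟩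
  set c := sSup T
  have hac : a < c := ht₀.1.trans_le (le_csSup hbdd ht₀)
  have hcb : c ≤ b := csSup_le ⟨t₀, ht₀⟩ fun t ht => ht.2.1
  have hlt : ∀ u, a < u → u < c → f u < f a := by
    intro u hau huc
    obtain ⟨t, ht, hut⟩ := exists_lt_of_lt_csSup ⟨t₀, ht₀⟩ huc
    exact ht.2.2 u ⟨hau, hut.le⟩
  have hc : f c < f a := by
    have h2 : ∀ᶠ u in nhdsWithin c (Set.Iio c), u ∈ Set.Ioo a c := Ioo_mem_nhdsLT hac
    obtain ⟨u, hu1, hu2⟩ := ((hl c (ha.trans hac)).and h2).exists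
    exact hu1.trans (hlt u hu2.1 hu2.2)
  rcases hcb.eq_or_lt with hcb' | hcb'
  · rwa [← hcb']
  · obtain ⟨t, ht, hct⟩ := hright c hac.le hcb' fun u hu =>
      hu.2.eq_or_lt.elim (fun h => h ▸ hc) (hlt u hu.1)
    exact absurd (le_csSup hbdd ht) (not_le.2 hct)

lemma HasDerivAt.eventually_mul_pos_right {f : ℝ → ℝ} {a f' d : ℝ} (hf : HasDerivAt f f' a)
    (h0 : f a = 0) (hd : 0 < f' * d) :
    (∀ᶠ b in nhdsWithin a (Set.Ioi a), 0 < f b * d) ∧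
      ∀ᶠ b in nhdsWithin a (Set.Iio a), f b * d < 0 := by
  have h1 : HasDerivAt (fun b => f b * d) (f' * d) a := hf.mul_const d
  have h2 := eventually_nhdsWithin_sign_eq_of_deriv_pos (f := fun b => f b * d) (x₀ := a)
    (by rwa [h1.deriv]) (by simp [h0])
  constructor
  · filter_upwards [nhdsWithin_le_nhds h2, self_mem_nhdsWithin] with b hb (hab : a < b)
    rw [sign_pos (sub_pos.2 hab)] at hb
    exact sign_eq_one_iff.1 hb
  · filter_upwards [nhdsWithin_le_nhds h2, self_mem_nhdsWithin] with b hb (hab : b < a)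
    rw [sign_neg (sub_neg.2 hab)] at hb
    exact sign_eq_neg_one_iff.1 hb

open Polynomial in
lemma orderEmbOfFin_roots_mem_Ioo {n : ℕ} {p : ℝ[X]} (hp : p ≠ 0)
    (h : p.roots.toFinset.card = n) {l r d : Fin n → ℝ} (hlr : ∀ j, l j < r j)
    (hl : ∀ j, p.eval (l j) * d j < 0) (hr : ∀ j, 0 < p.eval (r j) * d j)
    (hsep : ∀ i j, i < j → r i ≤ l j) (j : Fin n) :
    p.roots.toFinset.orderEmbOfFin h j ∈ Set.Ioo (l j) (r j) := by
  have hex : ∀ j, ∃ y ∈ Set.Ioo (l j) (r j), p.eval y = 0 := by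
    intro j
    obtain ⟨y, hy, hy0⟩ := intermediate_value_Ioo (hlr j).le
      (f := fun y => p.eval y * d j) (by fun_prop) ⟨hl j, hr j⟩
    refine ⟨y, hy, (mul_eq_zero.1 hy0).resolve_right ?_⟩
    intro hd
    simpa [hd] using hl j
  choose y hy hy0 using hex
  have := Finset.orderEmbOfFin_unique h (f := y) (fun j => by simp [hp, hy0 j])
    (fun i j hij => (hy i).2.trans ((hsep i j hij).trans_lt (hy j).1))
  rw [← this]
  exact hy j

open Polynomial in
/-- If at each zero the derivatives of `P a` in the parameter and in the variable have the same
sign, then all the zeros move to the left. -/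
lemma strictAntiOn_orderEmbOfFin_roots {n : ℕ} {P D : ℝ → ℝ[X]} {x : ℝ → Fin n → ℝ}
    (hP : ∀ a > 0, P a ≠ 0)
    (hcard : ∀ a > 0, (P a).roots.toFinset.card = n)
    (hx : ∀ a (ha : 0 < a), x a = (P a).roots.toFinset.orderEmbOfFin (hcard a ha))
    (hD : ∀ a > 0, ∀ y, HasDerivAt (fun b => (P b).eval y) ((D a).eval y) a)
    (hsign : ∀ a > 0, ∀ y, (P a).eval y = 0 → 0 < (D a).eval y * (P a).derivative.eval y)
    (j : Fin n) : StrictAntiOn (fun a => x a j) (Set.Ioi 0) := by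
  have hmono : ∀ a > 0, StrictMono (x a) := fun a ha => by
    rw [hx a ha]; exact OrderEmbedding.strictMono _
  have hroot : ∀ a > 0, ∀ j, (P a).eval (x a j) = 0 := fun a ha j => by
    have := Finset.orderEmbOfFin_mem _ (hcard a ha) j
    rw [← hx a ha] at this
    simpa [hP a ha] using this
  have hcont : ∀ a > 0, ∀ y d, ContinuousAt (fun b => (P b).eval y * d) a := fun a ha y d =>
    (hD a ha y).continuousAt.mul continuousAt_const
  have hd : ∀ a > 0, ∀ j, 0 < (P a).derivative.eval (x a j) * (P a).derivative.eval (x a j) :=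
    fun a ha j => mul_self_pos.2 (right_ne_zero_of_mul (hsign a ha _ (hroot a ha j)).ne')
  have hpos : ∀ a > (0 : ℝ), ∀ᶠ b in nhds a, 0 < b := fun a ha => lt_mem_nhds ha
  refine strictAntiOn_Ioi_of_eventually (fun a ha => ?_) (fun a ha => ?_)
  · have hm : ∀ j, ∃ m, m < x a j ∧ (∀ i, i < j → x a i ≤ m) ∧
        (P a).eval m * (P a).derivative.eval (x a j) < 0 := by
      intro j
      have h1 := (((P a).hasDerivAt (x a j)).eventually_mul_pos_right (hroot a ha j)
        (hd a ha j)).2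
      have h2 : ∀ᶠ m in nhdsWithin (x a j) (Set.Iio (x a j)), ∀ i, i < j → x a i ≤ m := by
        rw [Filter.eventually_all]
        intro i
        by_cases hij : i < j
        · filter_upwards [nhdsWithin_le_nhds (lt_mem_nhds (hmono a ha hij))] with m hm _
            using le_of_lt hm
        · simp [hij]
      obtain ⟨m, hm1, hm2, hm3⟩ := (h1.and (h2.and self_mem_nhdsWithin)).exists
      exact ⟨m, hm3, hm2, hm1⟩
    choose m hm1 hm2 hm3 using hm
    have e1 : ∀ᶠ b in nhdsWithin a (Set.Ioi a), ∀ j,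
        (P b).eval (m j) * (P a).derivative.eval (x a j) < 0 :=
      Filter.eventually_all.2 fun j =>
        nhdsWithin_le_nhds ((hcont a ha _ _).eventually_lt_const (hm3 j))
    have e2 : ∀ᶠ b in nhdsWithin a (Set.Ioi a), ∀ j,
        0 < (P b).eval (x a j) * (P a).derivative.eval (x a j) :=
      Filter.eventually_all.2 fun j =>
        ((hD a ha (x a j)).eventually_mul_pos_right (hroot a ha j)
          (hsign a ha _ (hroot a ha j))).1
    filter_upwards [e1, e2, nhdsWithin_le_nhds (hpos a ha)] with b h1 h2 hb
    rw [hx b hb]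
    exact (orderEmbOfFin_roots_mem_Ioo (hP b hb) (hcard b hb) hm1 h1 h2
      (fun i j hij => hm2 j i hij) j).2
  · have hm : ∀ j, ∃ m, x a j < m ∧ (∀ i, j < i → m ≤ x a i) ∧
        0 < (P a).eval m * (P a).derivative.eval (x a j) := by
      intro j
      have h1 := (((P a).hasDerivAt (x a j)).eventually_mul_pos_right (hroot a ha j)
        (hd a ha j)).1
      have h2 : ∀ᶠ m in nhdsWithin (x a j) (Set.Ioi (x a j)), ∀ i, j < i → m ≤ x a i := by
        rw [Filter.eventually_all]
        intro i
        by_cases hij : j < i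
        · filter_upwards [nhdsWithin_le_nhds (gt_mem_nhds (hmono a ha hij))] with m hm _
            using le_of_lt hm
        · simp [hij]
      obtain ⟨m, hm1, hm2, hm3⟩ := (h1.and (h2.and self_mem_nhdsWithin)).exists
      exact ⟨m, hm3, hm2, hm1⟩
    choose m hm1 hm2 hm3 using hm
    have e1 : ∀ᶠ b in nhdsWithin a (Set.Iio a), ∀ j,
        0 < (P b).eval (m j) * (P a).derivative.eval (x a j) :=
      Filter.eventually_all.2 fun j =>
        nhdsWithin_le_nhds ((hcont a ha _ _).eventually_const_lt (hm3 j))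
    have e2 : ∀ᶠ b in nhdsWithin a (Set.Iio a), ∀ j,
        (P b).eval (x a j) * (P a).derivative.eval (x a j) < 0 :=
      Filter.eventually_all.2 fun j =>
        ((hD a ha (x a j)).eventually_mul_pos_right (hroot a ha j)
          (hsign a ha _ (hroot a ha j))).2
    filter_upwards [e1, e2, nhdsWithin_le_nhds (hpos a ha)] with b h1 h2 hb
    rw [hx b hb]
    exact (orderEmbOfFin_roots_mem_Ioo (hP b hb) (hcard b hb) hm1 h2 h1
      (fun i j hij => hm2 i j hij) j).1

open Polynomial in
/-- `(X;q)_k` as a polynomial. -/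
noncomputable def qpochPoly (q : ℝ) (k : ℕ) : ℝ[X] :=
  ∏ j ∈ Finset.range k, (1 - C (q ^ j) * X)

lemma eval_qpochPoly (q y : ℝ) (k : ℕ) : (qpochPoly q k).eval y = qpoch q y k := by
  simp [qpochPoly, qpoch, Polynomial.eval_prod, mul_comm]

lemma natDegree_qpochPoly {q : ℝ} (hq : q ≠ 0) (k : ℕ) : (qpochPoly q k).natDegree = k := by
  have h : ∀ j, (1 - Polynomial.C (q ^ j) * Polynomial.X).natDegree = 1 := fun j => by
    have := pow_ne_zero j hq
    generalize q ^ j = a at *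
    compute_degree!
  rw [qpochPoly, Polynomial.natDegree_prod]
  · simp only [h, Finset.sum_const, Finset.card_range, smul_eq_mul, mul_one]
  · intro j _ h0
    have := h j
    rw [h0, Polynomial.natDegree_zero] at this
    exact zero_ne_one this

/-- The coefficient of `(x;q)_k` in the `q`-Krawtchouk polynomial. -/
noncomputable def qKrawtchoukCoeff (q : ℝ) (N n k : ℕ) (α : ℝ) : ℝ :=
  qpoch q (q ^ (-(n : ℤ))) k * qpoch q (-α * q ^ n) k /
    (qpoch q (q ^ ((1 : ℤ) - (N : ℤ))) k * qpoch q q k) * q ^ k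

lemma differentiable_qKrawtchoukCoeff (q : ℝ) (N n k : ℕ) :
    Differentiable ℝ (qKrawtchoukCoeff q N n k) := by
  unfold qKrawtchoukCoeff
  have : Differentiable ℝ fun α : ℝ => qpoch q (-α * q ^ n) k := by
    unfold qpoch
    exact Differentiable.fun_finsetProd fun j _ => by fun_prop
  exact ((this.const_mul _).div_const _).mul_const _

lemma qKrawtchoukCoeff_self_ne_zero {q : ℝ} (hq0 : 0 < q) (hq1 : q < 1) {M n : ℕ} (hn : n ≤ M)
    {α : ℝ} (hα : 0 < α) : qKrawtchoukCoeff q (M + 1) n n α ≠ 0 := by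
  have e1 : q ^ (-(n : ℤ)) = q⁻¹ ^ n := by simp
  have e2 : q ^ ((1 : ℤ) - ((M + 1 : ℕ) : ℤ)) = q⁻¹ ^ M := by
    rw [show (1 : ℤ) - ((M + 1 : ℕ) : ℤ) = -(M : ℤ) by push_cast; ring]; simp
  have h1 := qpoch_inv_ne_zero hq0 hq1 (le_refl n)
  have h2 := qpoch_inv_ne_zero hq0 hq1 hn
  have h3 := (qpoch_self_pos hq0 hq1 n).ne'
  have h4 := (qpoch_neg_pos hq0 (show 0 < α * q ^ n by positivity) n).ne'
  rw [qKrawtchoukCoeff, e1, e2, neg_mul]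
  positivity

open Polynomial in
/-- The `q`-Pochhammer expansion with coefficients `c`. -/
noncomputable def qpochExpansion (q : ℝ) (n : ℕ) (c : ℕ → ℝ) : ℝ[X] :=
  ∑ k ∈ Finset.range (n + 1), C (c k) * qpochPoly q k

lemma eval_qpochExpansion (q : ℝ) (n : ℕ) (c : ℕ → ℝ) (y : ℝ) :
    (qpochExpansion q n c).eval y = ∑ k ∈ Finset.range (n + 1), c k * qpoch q y k := by
  simp [qpochExpansion, Polynomial.eval_finsetSum, eval_qpochPoly]

lemma natDegree_qpochExpansion_le {q : ℝ} (hq : q ≠ 0) (n : ℕ) (c : ℕ → ℝ) :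
    (qpochExpansion q n c).natDegree ≤ n :=
  Polynomial.natDegree_sum_le_of_forall_le _ _ fun k hk =>
    (Polynomial.natDegree_C_mul_le _ _).trans
      ((natDegree_qpochPoly hq k).trans_le (Nat.lt_succ_iff.1 (Finset.mem_range.1 hk)))

lemma natDegree_qpochExpansion {q : ℝ} (hq : q ≠ 0) {n : ℕ} (hn : 1 ≤ n) {c : ℕ → ℝ}
    (hc : c n ≠ 0) : (qpochExpansion q n c).natDegree = n := by
  obtain ⟨m, rfl⟩ : ∃ m, n = m + 1 := ⟨n - 1, by omega⟩
  have h1 : (Polynomial.C (c (m + 1)) * qpochPoly q (m + 1)).natDegree = m + 1 := by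
    rw [Polynomial.natDegree_C_mul hc, natDegree_qpochPoly hq]
  have h2 := natDegree_qpochExpansion_le hq m c
  rw [qpochExpansion, Finset.sum_range_succ, ← qpochExpansion,
    Polynomial.natDegree_add_eq_right_of_natDegree_lt (by omega), h1]

lemma eval_qpochExpansion_qKrawtchoukCoeff (q : ℝ) (N n : ℕ) (α y : ℝ) :
    (qpochExpansion q n fun k => qKrawtchoukCoeff q N n k α).eval y =
      qKrawtchoukPoly q N n α y := by
  rw [eval_qpochExpansion, qKrawtchoukPoly]
  refine Finset.sum_congr rfl fun k _ => ?_
  rw [qKrawtchoukCoeff]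
  ring

open Polynomial in
/-- Orthogonality of the `q`-Krawtchouk polynomial to all polynomials of smaller degree. -/
lemma sum_weight_mul_qKrawtchouk_mul_eval {q : ℝ} (hq0 : 0 < q) (hq1 : q < 1) {M n : ℕ}
    (hn : n ≤ M) {α : ℝ} (hα : 0 < α) (g : ℝ[X]) (hg : g.natDegree < n) :
    ∑ x ∈ Finset.range (M + 1),
      (-1) ^ x * (qpoch q (q⁻¹ ^ M) x / qpoch q q x) * α⁻¹ ^ x *
        qKrawtchoukPoly q (M + 1) n α (q⁻¹ ^ x) * g.eval (q⁻¹ ^ x) = 0 := by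
  simp only [eval_eq_sum_range' hg, Finset.mul_sum]
  rw [Finset.sum_comm]
  refine Finset.sum_eq_zero fun m hm => ?_
  rw [← mul_zero (g.coeff m),
    ← sum_weight_mul_qKrawtchouk_mul_pow hq0 hq1 hn (Finset.mem_range.1 hm) hα, Finset.mul_sum]
  exact Finset.sum_congr rfl fun x _ => by ring

/-- zeros of q-Krawtchouk polynomials: monotonicity in `α`. -/
theorem stmt_11 (q : ℝ) (hq0 : 0 < q) (hq1 : q < 1) (N n : ℕ) (hN : 2 ≤ N) (hn : 1 ≤ n)
    (hnN : n ≤ N - 1) :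
    ∃ x : ℝ → Fin n → ℝ,
      (∀ α : ℝ, 0 < α →
        StrictMono (x α) ∧
        (∀ j, qKrawtchoukPoly q N n α (x α j) = 0) ∧
        (∀ y : ℝ, qKrawtchoukPoly q N n α y = 0 → ∃ j, y = x α j)) ∧
      (∀ j, StrictAntiOn (fun α => x α j) (Set.Ioi 0)) := by
  obtain ⟨M, rfl⟩ : ∃ M, N = M + 1 := ⟨N - 1, by omega⟩
  have hnM : n ≤ M := hnN
  set P : ℝ → Polynomial ℝ := fun α =>
    qpochExpansion q n fun k => qKrawtchoukCoeff q (M + 1) n k α with hPdef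
  set D : ℝ → Polynomial ℝ := fun α =>
    qpochExpansion q n fun k => deriv (qKrawtchoukCoeff q (M + 1) n k) α with hDdef
  set z : ℕ → ℝ := fun x => q⁻¹ ^ x with hz
  set c : ℕ → ℝ := fun x => (-1) ^ x * (qpoch q (q⁻¹ ^ M) x / qpoch q q x) with hc
  have hzmono : StrictMono z := pow_right_strictMono₀ ((one_lt_inv₀ hq0).2 hq1)
  have hzlim : Filter.Tendsto z Filter.atTop Filter.atTop :=
    tendsto_pow_atTop_atTop_of_one_lt ((one_lt_inv₀ hq0).2 hq1)
  have hcpos : ∀ x ∈ Finset.range (M + 1), 0 < c x := fun x hx => by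
    simp only [hc]
    rw [← mul_div_assoc]
    exact div_pos (neg_one_pow_mul_qpoch_inv_pos hq0 hq1 (Nat.lt_succ_iff.1 (Finset.mem_range.1 hx)))
      (qpoch_self_pos hq0 hq1 x)
  have hPeval : ∀ α y, (P α).eval y = qKrawtchoukPoly q (M + 1) n α y := fun α y =>
    eval_qpochExpansion_qKrawtchoukCoeff q (M + 1) n α y
  have hPdeg : ∀ α > 0, (P α).natDegree = n := fun α hα =>
    natDegree_qpochExpansion hq0.ne' hn (qKrawtchoukCoeff_self_ne_zero hq0 hq1 hnM hα)
  have hP0 : ∀ α > 0, P α ≠ 0 := fun α hα h => by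
    have := hPdeg α hα
    rw [h, Polynomial.natDegree_zero] at this
    omega
  have hw : ∀ α > 0, ∀ x ∈ Finset.range (M + 1), 0 < c x * α⁻¹ ^ x := fun α hα x hx =>
    mul_pos (hcpos x hx) (pow_pos (inv_pos.2 hα) x)
  have horth : ∀ α > 0, ∀ g : Polynomial ℝ, g.natDegree < n →
      ∑ x ∈ Finset.range (M + 1), c x * α⁻¹ ^ x * (P α).eval (z x) * g.eval (z x) = 0 :=
    fun α hα g hg => by
      simp only [hPeval]
      exact sum_weight_mul_qKrawtchouk_mul_eval hq0 hq1 hnM hα g hg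
  have hderiv : ∀ α > 0, ∀ y, HasDerivAt (fun a => (P a).eval y) ((D α).eval y) α := by
    intro α _ y
    simp only [hPdef, hDdef, eval_qpochExpansion]
    exact HasDerivAt.fun_sum fun k _ =>
      ((differentiable_qKrawtchoukCoeff q (M + 1) n k α).hasDerivAt).mul_const _
  have hder : ∀ α > 0, ∀ g : Polynomial ℝ, g.natDegree < n →
      ∑ x ∈ Finset.range (M + 1), c x * α⁻¹ ^ x * (D α).eval (z x) * g.eval (z x) =
      α⁻¹ * ∑ x ∈ Finset.range (M + 1),
        (x : ℝ) * (c x * α⁻¹ ^ x * (P α).eval (z x) * g.eval (z x)) := by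
    intro α hα g hg
    have h1 : HasDerivAt
        (fun a => ∑ x ∈ Finset.range (M + 1), c x * a⁻¹ ^ x * (P a).eval (z x) * g.eval (z x))
        (∑ x ∈ Finset.range (M + 1), (c x * (-(x : ℝ) * α⁻¹ ^ x * α⁻¹) * (P α).eval (z x) +
          c x * α⁻¹ ^ x * (D α).eval (z x)) * g.eval (z x)) α := by
      refine HasDerivAt.fun_sum fun x _ => ?_
      refine HasDerivAt.mul_const (HasDerivAt.mul (HasDerivAt.const_mul _ ?_)
        (hderiv α hα (z x))) _
      refine ((hasDerivAt_inv hα.ne').pow x).congr_deriv ?_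
      rcases x with _ | x
      · simp
      · simp only [Nat.add_sub_cancel, pow_succ]
        push_cast
        field_simp
    have h2 : HasDerivAt
        (fun a => ∑ x ∈ Finset.range (M + 1), c x * a⁻¹ ^ x * (P a).eval (z x) * g.eval (z x))
        0 α := by
      refine (hasDerivAt_const α (0 : ℝ)).congr_of_eventuallyEq ?_
      filter_upwards [lt_mem_nhds hα] with a ha using horth a ha g hg
    rw [← sub_eq_zero, ← h1.unique h2, Finset.mul_sum, ← Finset.sum_sub_distrib]
    exact Finset.sum_congr rfl fun x _ => by ring
  have hsign : ∀ α > 0, ∀ y, (P α).eval y = 0 →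
      0 < (D α).eval y * (P α).derivative.eval y := by
    intro α hα y hy
    have := eval_mul_eval_derivative_pos_of_orthogonal hnM hn hzmono hzlim (hw α hα)
      (D := Polynomial.C α * D α) (hPdeg α hα)
      ((Polynomial.natDegree_C_mul_le _ _).trans (natDegree_qpochExpansion_le hq0.ne' n _))
      (horth α hα) (fun g hg => by
        rw [← one_mul (∑ x ∈ Finset.range (M + 1), (x : ℝ) * _), ← mul_inv_cancel₀ hα.ne',
          mul_assoc, ← hder α hα g hg, Finset.mul_sum]
        refine Finset.sum_congr rfl fun x _ => ?_
        rw [Polynomial.eval_C_mul]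
        ring) hy
    rw [Polynomial.eval_C_mul, mul_assoc] at this
    exact pos_of_mul_pos_right this hα.le
  have hcard : ∀ α > 0, (P α).roots.toFinset.card = n := fun α hα =>
    card_roots_toFinset_of_orthogonal hnM hn hzmono (hw α hα) (hPdeg α hα) (horth α hα)
  refine ⟨fun α => if h : 0 < α then (P α).roots.toFinset.orderEmbOfFin (hcard α h) else 0,
    fun α hα => ?_, strictAntiOn_orderEmbOfFin_roots hP0 hcard (fun α hα => dif_pos hα) hderiv
      hsign⟩
  simp only [dif_pos hα]
  refine ⟨OrderEmbedding.strictMono _, fun j => ?_, fun y hy => ?_⟩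
  · have := Finset.orderEmbOfFin_mem _ (hcard α hα) j
    rw [← hPeval]
    rw [Multiset.mem_toFinset, Polynomial.mem_roots (hP0 α hα)] at this
    exact this
  · rw [← hPeval] at hy
    have : y ∈ Set.range ((P α).roots.toFinset.orderEmbOfFin (hcard α hα)) := by
      rw [Finset.range_orderEmbOfFin]
      simpa [hP0 α hα] using hy
    obtain ⟨j, hj⟩ := this
    exact ⟨j, hj.symm⟩
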